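/- arXiv:1404.4638 — 3 statements merged into one kernel-verified Lean document; each statement's English description precedes it below -/
import Mathlib

section
/- For every continuously differentiable function u : ℝ² → ℝ with compact support, one has ‖u‖²_{L⁴(ℝ²)} ≤ 2 ‖u‖_{L²(ℝ²)} ‖∇u‖_{L²(ℝ²)}, i.e. (∫_{ℝ²} u⁴ dx dy)^{1/2} ≤ 2 (∫_{ℝ²} u² dx dy)^{1/2} (∫_{ℝ²} (u_x² + u_y²) dx dy)^{1/2}. -/
open MeasureTheory Real

/-- A compactly supported `C¹` function on the line is bounded by the `L¹` norm of its derivative. -/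
lemma abs_le_integral_abs_deriv {f : ℝ → ℝ} (hf : ContDiff ℝ 1 f) (hs : HasCompactSupport f)
    (x : ℝ) : |f x| ≤ ∫ t, |deriv f t| := by
  have hint : Integrable (deriv f) :=
    (hf.continuous_deriv le_rfl).integrable_of_hasCompactSupport hs.deriv
  rw [← hs.integral_Iic_deriv_eq hf x]
  calc |∫ t in Set.Iic x, deriv f t| ≤ ∫ t in Set.Iic x, |deriv f t| :=
        abs_integral_le_integral_abs
    _ ≤ ∫ t, |deriv f t| :=
        setIntegral_le_integral hint.abs (Filter.Eventually.of_forall fun t => abs_nonneg _)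

/-- The Cauchy–Schwarz inequality for continuous compactly supported functions. -/
lemma integral_abs_mul_le_sqrt_mul_sqrt {f g : ℝ × ℝ → ℝ} (hf : Continuous f)
    (hfs : HasCompactSupport f) (hg : Continuous g) (hgs : HasCompactSupport g) :
    ∫ p, |f p * g p| ≤ √(∫ p, f p ^ 2) * √(∫ p, g p ^ 2) := by
  have h := integral_mul_norm_le_Lp_mul_Lq (μ := volume) Real.HolderConjugate.two_two
    (hf.memLp_of_hasCompactSupport (p := ENNReal.ofReal 2) hfs)
    (hg.memLp_of_hasCompactSupport (p := ENNReal.ofReal 2) hgs)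
  simpa [Real.sqrt_eq_rpow, abs_mul] using h

/-- The two-dimensional Gagliardo–Nirenberg–Sobolev inequality with both partial derivatives:
the integral of `w²` is at most the product of the `L¹` norms of the partial derivatives. -/
lemma integral_sq_le_integral_abs_fderiv_mul {w : ℝ × ℝ → ℝ} (hw : ContDiff ℝ 1 w)
    (hs : HasCompactSupport w) :
    ∫ p, w p ^ 2 ≤ (∫ p, |fderiv ℝ w p (1, 0)|) * ∫ p, |fderiv ℝ w p (0, 1)| := by
  have hint (v : ℝ × ℝ) : Integrable (fun p => |fderiv ℝ w p v|) :=
    (((hw.continuous_fderiv one_ne_zero).clm_apply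
      continuous_const).integrable_of_hasCompactSupport (hs.fderiv_apply ℝ v)).abs
  have hdiff := hw.differentiable one_ne_zero
  have hx (p : ℝ × ℝ) : |w p| ≤ ∫ s, |fderiv ℝ w (s, p.2) (1, 0)| := by
    have hd (s : ℝ) : deriv (fun s => w (s, p.2)) s = fderiv ℝ w (s, p.2) (1, 0) :=
      ((hdiff _).hasFDerivAt.comp_hasDerivAt s
        ((hasDerivAt_id s).prodMk (hasDerivAt_const s p.2))).deriv
    simpa only [hd] using abs_le_integral_abs_deriv (f := fun s => w (s, p.2))
      (hw.comp (contDiff_id.prodMk contDiff_const))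
      (hs.comp_isClosedEmbedding <| Function.LeftInverse.isClosedEmbedding
        (f := Prod.fst) (fun _ => rfl) continuous_fst (by fun_prop)) p.1
  have hy (p : ℝ × ℝ) : |w p| ≤ ∫ t, |fderiv ℝ w (p.1, t) (0, 1)| := by
    have hd (t : ℝ) : deriv (fun t => w (p.1, t)) t = fderiv ℝ w (p.1, t) (0, 1) :=
      ((hdiff _).hasFDerivAt.comp_hasDerivAt t
        ((hasDerivAt_const t p.1).prodMk (hasDerivAt_id t))).deriv
    simpa only [hd] using abs_le_integral_abs_deriv (f := fun t => w (p.1, t))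
      (hw.comp (contDiff_const.prodMk contDiff_id))
      (hs.comp_isClosedEmbedding <| Function.LeftInverse.isClosedEmbedding
        (f := Prod.snd) (fun _ => rfl) continuous_snd (by fun_prop)) p.2
  have hA := (hint (1, 0)).integral_prod_right
  have hB := (hint (0, 1)).integral_prod_left
  have hsq : HasCompactSupport (fun p => w p ^ 2) := hs.comp_left (g := (· ^ 2)) (by simp)
  calc ∫ p, w p ^ 2
      ≤ ∫ p : ℝ × ℝ, (∫ t, |fderiv ℝ w (p.1, t) (0, 1)|) *
          ∫ s, |fderiv ℝ w (s, p.2) (1, 0)| := by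
        refine integral_mono ((hw.continuous.pow 2).integrable_of_hasCompactSupport hsq)
          (hB.mul_prod hA) fun p => ?_
        rw [← sq_abs, sq]
        exact mul_le_mul (hy p) (hx p) (abs_nonneg _) ((abs_nonneg _).trans (hy p))
    _ = (∫ x, ∫ t, |fderiv ℝ w (x, t) (0, 1)|) * ∫ y, ∫ s, |fderiv ℝ w (s, y) (1, 0)| :=
        integral_prod_mul (μ := volume) (ν := volume)
          (fun x => ∫ t, |fderiv ℝ w (x, t) (0, 1)|) (fun y => ∫ s, |fderiv ℝ w (s, y) (1, 0)|)
    _ = (∫ p, |fderiv ℝ w p (1, 0)|) * ∫ p, |fderiv ℝ w p (0, 1)| := by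
        rw [mul_comm, Measure.volume_eq_prod, integral_prod_symm _ (hint (1, 0)),
          integral_prod _ (hint (0, 1))]

/-- The **Ladyzhenskaya inequality** in the plane, in terms of the Fréchet derivative. -/
lemma sqrt_integral_pow_four_le_fderiv {F : ℝ × ℝ → ℝ} (hF : ContDiff ℝ 1 F)
    (hs : HasCompactSupport F) :
    √(∫ p, F p ^ 4) ≤ 2 * √(∫ p, F p ^ 2) *
      √(∫ p, (fderiv ℝ F p (1, 0) ^ 2 + fderiv ℝ F p (0, 1) ^ 2)) := by
  have hdiff := hF.differentiable one_ne_zero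
  have hcont (v : ℝ × ℝ) : Continuous (fun p => fderiv ℝ F p v) :=
    (hF.continuous_fderiv one_ne_zero).clm_apply continuous_const
  have hcs (v : ℝ × ℝ) : HasCompactSupport (fun p => fderiv ℝ F p v) := hs.fderiv_apply ℝ v
  have hint (v : ℝ × ℝ) : Integrable (fun p => fderiv ℝ F p v ^ 2) :=
    have hsq : HasCompactSupport (fun p => fderiv ℝ F p v ^ 2) :=
      (hcs v).comp_left (g := (· ^ 2)) (by simp)
    ((hcont v).pow 2).integrable_of_hasCompactSupport hsq
  have hcauchy (v : ℝ × ℝ) : ∫ p, |fderiv ℝ (fun q => F q ^ 2) p v| ≤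
      2 * (√(∫ p, F p ^ 2) * √(∫ p, fderiv ℝ F p v ^ 2)) := by
    have hd (p : ℝ × ℝ) : |fderiv ℝ (fun q => F q ^ 2) p v| = 2 * |F p * fderiv ℝ F p v| := by
      rw [((hdiff p).hasFDerivAt.pow 2).fderiv]
      simp [abs_mul, mul_assoc]
    simp only [hd, integral_const_mul]
    gcongr
    exact integral_abs_mul_le_sqrt_mul_sqrt hF.continuous hs (hcont v) (hcs v)
  have hsq : HasCompactSupport (fun p => F p ^ 2) := hs.comp_left (g := (· ^ 2)) (by simp)
  have hmain := integral_sq_le_integral_abs_fderiv_mul (hF.pow 2) hsq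
  simp only [← pow_mul, Nat.reduceMul] at hmain
  rw [integral_add (hint (1, 0)) (hint (0, 1))]
  have hX : 0 ≤ ∫ p, fderiv ℝ F p (1, 0) ^ 2 := integral_nonneg fun p => sq_nonneg _
  have hY : 0 ≤ ∫ p, fderiv ℝ F p (0, 1) ^ 2 := integral_nonneg fun p => sq_nonneg _
  have hprod := hmain.trans (mul_le_mul (hcauchy (1, 0)) (hcauchy (0, 1))
    (integral_nonneg fun p => abs_nonneg _) (by positivity))
  refine Real.sqrt_le_iff.2 ⟨by positivity, hprod.trans ?_⟩
  rw [mul_pow, Real.sq_sqrt (add_nonneg hX hY)]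
  have ha := Real.sq_sqrt hX
  have hb := Real.sq_sqrt hY
  generalize √(∫ p, fderiv ℝ F p (1, 0) ^ 2) = a at ha ⊢
  generalize √(∫ p, fderiv ℝ F p (0, 1) ^ 2) = b at hb ⊢
  generalize √(∫ p, F p ^ 2) = c
  rw [← ha, ← hb]
  nlinarith [sq_nonneg (c * (a - b)), sq_nonneg (c * a), sq_nonneg (c * b)]

/-- **Gagliardo–Nirenberg (Ladyzhenskaya) inequality in the plane.**
For every continuously differentiable `u : ℝ² → ℝ` with compact support,
`‖u‖²_{L⁴(ℝ²)} ≤ 2 ‖u‖_{L²(ℝ²)} ‖∇u‖_{L²(ℝ²)}`, i.e.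
`(∫ u⁴)^{1/2} ≤ 2 (∫ u²)^{1/2} (∫ (u_x² + u_y²))^{1/2}`. -/
theorem gagliardo_nirenberg_plane (u : ℝ → ℝ → ℝ)
    (hu : ContDiff ℝ 1 (fun p : ℝ × ℝ => u p.1 p.2))
    (hsupp : HasCompactSupport (fun p : ℝ × ℝ => u p.1 p.2)) :
    Real.sqrt (∫ p : ℝ × ℝ, (u p.1 p.2)^4) ≤
      2 * Real.sqrt (∫ p : ℝ × ℝ, (u p.1 p.2)^2) *
        Real.sqrt (∫ p : ℝ × ℝ,
          ((deriv (fun x => u x p.2) p.1)^2 + (deriv (fun y => u p.1 y) p.2)^2)) := by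
  have hdiff := hu.differentiable one_ne_zero
  have hdx (p : ℝ × ℝ) : deriv (fun x => u x p.2) p.1 =
      fderiv ℝ (fun q : ℝ × ℝ => u q.1 q.2) p (1, 0) :=
    ((hdiff p).hasFDerivAt.comp_hasDerivAt (f := fun s => (s, p.2)) p.1
      ((hasDerivAt_id p.1).prodMk (hasDerivAt_const p.1 p.2))).deriv
  have hdy (p : ℝ × ℝ) : deriv (fun y => u p.1 y) p.2 =
      fderiv ℝ (fun q : ℝ × ℝ => u q.1 q.2) p (0, 1) :=
    ((hdiff p).hasFDerivAt.comp_hasDerivAt (f := fun t => (p.1, t)) p.2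
      ((hasDerivAt_const p.2 p.1).prodMk (hasDerivAt_id p.2))).deriv
  simp only [hdx, hdy]
  exact sqrt_integral_pow_four_le_fderiv hu hsupp
end

section
/- Fix B > 0, b > 0, M ≥ 0 and let S = ℝ × (0,B). For every continuously differentiable function u on ℝ × [0,B] with compact support satisfying u(x,0) = u(x,B) = 0 for all x ∈ ℝ and ∫_S u² dx dy ≤ M², one has (4b/3) ∫_S e^{2bx} u³ dx dy ≤ b ∫_S e^{2bx} u_y² dx dy + 2b ∫_S e^{2bx} u_x² dx dy + 2(b³ + (8b/9) M²) ∫_S e^{2bx} u² dx dy. -/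
open MeasureTheory Real Set

/-- The strip `S = ℝ × (0, B)`. -/
def strip (B : ℝ) : Set (ℝ × ℝ) := Set.univ ×ˢ Set.Ioo 0 B

/-- **Cauchy–Schwarz** for integrals, in squared form. -/
lemma sq_integral_mul_le {α : Type*} [MeasurableSpace α] {μ : Measure α} {f g : α → ℝ}
    (hff : Integrable (fun a => f a ^ 2) μ) (hfg : Integrable (fun a => f a * g a) μ)
    (hgg : Integrable (fun a => g a ^ 2) μ) :
    (∫ a, f a * g a ∂μ) ^ 2 ≤ (∫ a, f a ^ 2 ∂μ) * ∫ a, g a ^ 2 ∂μ := by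
  have hdiscrim : discrim (∫ a, f a ^ 2 ∂μ) (2 * ∫ a, f a * g a ∂μ) (∫ a, g a ^ 2 ∂μ) ≤ 0 := by
    refine discrim_le_zero fun t => ?_
    have hexpand : ∫ a, (t * f a + g a) ^ 2 ∂μ
        = (∫ a, f a ^ 2 ∂μ) * (t * t) + 2 * (∫ a, f a * g a ∂μ) * t + ∫ a, g a ^ 2 ∂μ := by
      calc ∫ a, (t * f a + g a) ^ 2 ∂μ
          = ∫ a, ((t * t) * f a ^ 2 + (2 * t) * (f a * g a)) + g a ^ 2 ∂μ := by
            congr 1 with a; ring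
        _ = _ := by
            rw [integral_add (by fun_prop) hgg, integral_add (hff.const_mul _) (hfg.const_mul _),
              integral_const_mul, integral_const_mul]
            ring
    rw [← hexpand]
    exact integral_nonneg fun a => sq_nonneg _
  rw [discrim] at hdiscrim
  linarith

/-- A function vanishing at `a` has its square at `x ≥ a` controlled by the integral of
`|f f'|` over any set containing `(a, x)`. -/
lemma sq_le_two_mul_setIntegral_abs_mul {f f' : ℝ → ℝ} (hf : ∀ t, HasDerivAt f (f' t) t)
    (hf' : Continuous f') {a x : ℝ} (hax : a ≤ x) (ha : f a = 0) {s : Set ℝ}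
    (hs : Ioo a x ⊆ s) (hfi : IntegrableOn (fun t => |f t * f' t|) s) :
    f x ^ 2 ≤ 2 * ∫ t in s, |f t * f' t| := by
  have hcont : Continuous f := continuous_iff_continuousAt.2 fun t => (hf t).continuousAt
  have hftc : ∫ t in a..x, 2 * (f t * f' t) = f x ^ 2 - f a ^ 2 := by
    refine intervalIntegral.integral_eq_sub_of_hasDerivAt (f := fun t => f t ^ 2) (fun t _ => ?_)
      (Continuous.intervalIntegrable (by fun_prop) _ _)
    convert! (hf t).pow 2 using 1
    ring
  calc f x ^ 2 = 2 * ∫ t in a..x, f t * f' t := by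
        rw [← intervalIntegral.integral_const_mul, hftc, ha]; ring
    _ ≤ 2 * ∫ t in a..x, |f t * f' t| := by
        gcongr
        exact intervalIntegral.integral_mono_on hax
          (Continuous.intervalIntegrable (by fun_prop) _ _)
          (Continuous.intervalIntegrable (by fun_prop) _ _) fun t _ => le_abs_self _
    _ = 2 * ∫ t in Ioo a x, |f t * f' t| := by
        rw [intervalIntegral.integral_of_le hax, integral_Ioc_eq_integral_Ioo]
    _ ≤ 2 * ∫ t in s, |f t * f' t| := by
        exact mul_le_mul_of_nonneg_left
          (setIntegral_mono_set hfi (ae_of_all _ fun t => abs_nonneg _) hs.eventuallyLE)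
          zero_le_two

lemma HasCompactSupport.exists_le_apply_eq_zero {f : ℝ → ℝ} (hf : HasCompactSupport f) (x : ℝ) :
    ∃ a ≤ x, f a = 0 := by
  obtain ⟨c, hc⟩ := hf.isCompact.bddBelow
  refine ⟨min x (c - 1), min_le_left _ _, ?_⟩
  by_contra h
  have := hc (subset_tsupport f h)
  linarith [min_le_right x (c - 1)]

lemma HasCompactSupport.comp_prodMk_left {f : ℝ × ℝ → ℝ} (hf : HasCompactSupport f) (x : ℝ) :
    HasCompactSupport fun y => f (x, y) :=
  HasCompactSupport.intro (hf.isCompact.image continuous_snd) fun y hy =>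
    image_eq_zero_of_notMem_tsupport fun h => hy ⟨(x, y), h, rfl⟩

lemma HasCompactSupport.comp_prodMk_right {f : ℝ × ℝ → ℝ} (hf : HasCompactSupport f) (y : ℝ) :
    HasCompactSupport fun x => f (x, y) :=
  HasCompactSupport.intro (hf.isCompact.image continuous_fst) fun x hx =>
    image_eq_zero_of_notMem_tsupport fun h => hx ⟨(x, y), h, rfl⟩

lemma volume_restrict_strip (B : ℝ) :
    (volume : Measure (ℝ × ℝ)).restrict (strip B)
      = (volume : Measure ℝ).prod (volume.restrict (Ioo 0 B)) := by
  rw [strip, Measure.volume_eq_prod, ← Measure.prod_restrict, Measure.restrict_univ]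

lemma measurableSet_strip (B : ℝ) : MeasurableSet (strip B) :=
  MeasurableSet.univ.prod measurableSet_Ioo

lemma Continuous.integrableOn_strip {B : ℝ} {f : ℝ × ℝ → ℝ} (hf : Continuous f)
    (hcf : HasCompactSupport f) : IntegrableOn f (strip B) :=
  (hf.integrable_of_hasCompactSupport hcf).integrableOn

lemma HasCompactSupport.fun_pow_real {f : ℝ × ℝ → ℝ} (hf : HasCompactSupport f) {n : ℕ}
    (hn : n ≠ 0) : HasCompactSupport fun p => f p ^ n :=
  hf.comp_left (g := fun r => r ^ n) (zero_pow hn)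

/-- **Ladyzhenskaya's inequality** on the strip, before Cauchy–Schwarz is applied to the right-hand
side. -/
lemma integral_strip_pow_four_le {B : ℝ} {v vx vy : ℝ × ℝ → ℝ} (hsupp : HasCompactSupport v)
    (hv : Continuous v) (hvx : Continuous vx) (hvy : Continuous vy)
    (hdx : ∀ x y, HasDerivAt (fun t => v (t, y)) (vx (x, y)) x)
    (hdy : ∀ x y, HasDerivAt (fun t => v (x, t)) (vy (x, y)) y)
    (hbd : ∀ x, v (x, 0) = 0) :
    ∫ p in strip B, v p ^ 4
      ≤ 4 * ((∫ p in strip B, |v p * vx p|) * ∫ p in strip B, |v p * vy p|) := by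
  have hcx : HasCompactSupport fun p => |v p * vx p| :=
    (hsupp.mul_right (f' := vx)).abs
  have hcy : HasCompactSupport fun p => |v p * vy p| :=
    (hsupp.mul_right (f' := vy)).abs
  have hix : IntegrableOn (fun p => |v p * vx p|) (strip B) :=
    Continuous.integrableOn_strip (by fun_prop) hcx
  have hiy : IntegrableOn (fun p => |v p * vy p|) (strip B) :=
    Continuous.integrableOn_strip (by fun_prop) hcy
  have hi4 : IntegrableOn (fun p => v p ^ 4) (strip B) :=
    Continuous.integrableOn_strip (by fun_prop) (hsupp.fun_pow_real four_ne_zero)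
  have hboundx : ∀ p, v p ^ 2 ≤ 2 * ∫ t, |v (t, p.2) * vx (t, p.2)| := fun ⟨x, y⟩ => by
    obtain ⟨a, hax, ha⟩ := (hsupp.comp_prodMk_right y).exists_le_apply_eq_zero x
    rw [← setIntegral_univ]
    refine sq_le_two_mul_setIntegral_abs_mul (hdx · y) (by fun_prop) hax ha (subset_univ _) ?_
    exact (Continuous.integrable_of_hasCompactSupport (by fun_prop)
      (hcx.comp_prodMk_right y)).integrableOn
  have hboundy : ∀ p ∈ strip B, v p ^ 2 ≤ 2 * ∫ t in Ioo 0 B, |v (p.1, t) * vy (p.1, t)| :=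
    fun ⟨x, y⟩ hp => by
      refine sq_le_two_mul_setIntegral_abs_mul (hdy x) (by fun_prop) hp.2.1.le (hbd x)
        (Ioo_subset_Ioo_right hp.2.2.le) ?_
      exact (Continuous.integrable_of_hasCompactSupport (by fun_prop)
        (hcy.comp_prodMk_left x)).integrableOn
  have hbound : ∀ p ∈ strip B, v p ^ 4 ≤ 4 * ((∫ t in Ioo 0 B, |v (p.1, t) * vy (p.1, t)|)
      * ∫ t, |v (t, p.2) * vx (t, p.2)|) := fun p hp => by
    have := mul_le_mul (hboundx p) (hboundy p hp) (sq_nonneg _)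
      ((sq_nonneg _).trans (hboundx p))
    linarith [show v p ^ 4 = v p ^ 2 * v p ^ 2 by ring]
  have hmono := fun hfi => setIntegral_mono_on hi4 hfi (measurableSet_strip B) hbound
  rw [IntegrableOn, volume_restrict_strip] at hix hiy
  rw [IntegrableOn, volume_restrict_strip] at hmono
  rw [volume_restrict_strip]
  refine (hmono ((hiy.integral_prod_left.mul_prod hix.integral_prod_right).const_mul 4)).trans ?_
  rw [integral_const_mul, integral_prod_mul (fun x => ∫ t in Ioo 0 B, |v (x, t) * vy (x, t)|)
      (fun y => ∫ t, |v (t, y) * vx (t, y)|), integral_prod _ hiy, integral_prod_symm _ hix,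
    mul_comm (∫ _, _)]

/-- **Gagliardo–Nirenberg inequality** on the strip. -/
lemma integral_strip_pow_four_le_mul {B : ℝ} {v vx vy : ℝ × ℝ → ℝ} (hsupp : HasCompactSupport v)
    (hv : Continuous v) (hvx : Continuous vx) (hvy : Continuous vy)
    (hcvx : HasCompactSupport vx) (hcvy : HasCompactSupport vy)
    (hdx : ∀ x y, HasDerivAt (fun t => v (t, y)) (vx (x, y)) x)
    (hdy : ∀ x y, HasDerivAt (fun t => v (x, t)) (vy (x, y)) y)
    (hbd : ∀ x, v (x, 0) = 0) :
    ∫ p in strip B, v p ^ 4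
      ≤ 2 * ((∫ p in strip B, v p ^ 2)
        * ((∫ p in strip B, vx p ^ 2) + ∫ p in strip B, vy p ^ 2)) := by
  have hLad := integral_strip_pow_four_le (B := B) hsupp hv hvx hvy hdx hdy hbd
  have hCS : ∀ w : ℝ × ℝ → ℝ, Continuous w → HasCompactSupport w →
      (∫ p in strip B, |v p * w p|) ^ 2
        ≤ (∫ p in strip B, v p ^ 2) * ∫ p in strip B, w p ^ 2 := fun w hw hcw => by
    have hsq : ∀ f : ℝ × ℝ → ℝ, Continuous f → HasCompactSupport f →
        IntegrableOn (fun p => |f p| ^ 2) (strip B) := fun f hf hcf =>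
      Continuous.integrableOn_strip (by fun_prop) (hcf.abs.fun_pow_real two_ne_zero)
    have hmul : IntegrableOn (fun p => |v p| * |w p|) (strip B) :=
      Continuous.integrableOn_strip (by fun_prop) hsupp.abs.mul_right
    simpa only [sq_abs, abs_mul] using sq_integral_mul_le (hsq v hv hsupp) hmul (hsq w hw hcw)
  have hx := hCS vx hvx hcvx
  have hy := hCS vy hvy hcvy
  have hA : 0 ≤ ∫ p in strip B, v p ^ 2 := integral_nonneg fun p => sq_nonneg _
  have hX : 0 ≤ ∫ p in strip B, vx p ^ 2 := integral_nonneg fun p => sq_nonneg _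
  have hY : 0 ≤ ∫ p in strip B, vy p ^ 2 := integral_nonneg fun p => sq_nonneg _
  have hP : 0 ≤ ∫ p in strip B, |v p * vx p| := integral_nonneg fun p => abs_nonneg _
  have hR : 0 ≤ ∫ p in strip B, |v p * vy p| := integral_nonneg fun p => abs_nonneg _
  refine hLad.trans ?_
  nlinarith [sq_nonneg ((∫ p in strip B, |v p * vx p|) - ∫ p in strip B, |v p * vy p|)]

/-- **Weighted estimate for the cubic term** (estimate (3.11) of the paper).
Fix `B > 0`, `b > 0`, `M ≥ 0`. For every continuously differentiable `u` on the
strip with compact support, vanishing on the horizontal boundaries and with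
`∫_S u² ≤ M²`, one has
`(4b/3) ∫_S e^{2bx} u³ ≤ b ∫_S e^{2bx} u_y² + 2b ∫_S e^{2bx} u_x²
  + 2(b³ + (8b/9) M²) ∫_S e^{2bx} u²`. -/
theorem weighted_cubic_estimate (B b M : ℝ) (hB : 0 < B) (hb : 0 < b) (hM : 0 ≤ M)
    (u : ℝ → ℝ → ℝ)
    (hu : ContDiff ℝ 1 (fun p : ℝ × ℝ => u p.1 p.2))
    (hsupp : HasCompactSupport (fun p : ℝ × ℝ => u p.1 p.2))
    (hbd0 : ∀ x : ℝ, u x 0 = 0) (hbdB : ∀ x : ℝ, u x B = 0)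
    (hL2 : ∫ p in strip B, (u p.1 p.2)^2 ≤ M^2) :
    (4*b/3) * ∫ p in strip B, Real.exp (2*b*p.1) * (u p.1 p.2)^3 ≤
      b * (∫ p in strip B, Real.exp (2*b*p.1) * (deriv (fun y => u p.1 y) p.2)^2)
      + 2*b * (∫ p in strip B, Real.exp (2*b*p.1) * (deriv (fun x => u x p.2) p.1)^2)
      + 2*(b^3 + (8*b/9)*M^2) * (∫ p in strip B, Real.exp (2*b*p.1) * (u p.1 p.2)^2) := by
  set w : ℝ × ℝ → ℝ := fun p => u p.1 p.2 with hw_def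
  set ux : ℝ × ℝ → ℝ := fun p => fderiv ℝ w p (1, 0) with hux_def
  set uy : ℝ × ℝ → ℝ := fun p => fderiv ℝ w p (0, 1) with huy_def
  have hwc : Continuous w := hu.continuous
  have huxc : Continuous ux := (hu.continuous_fderiv one_ne_zero).clm_apply continuous_const
  have huyc : Continuous uy := (hu.continuous_fderiv one_ne_zero).clm_apply continuous_const
  have huxs : HasCompactSupport ux := hsupp.fderiv_apply ℝ _
  have huys : HasCompactSupport uy := hsupp.fderiv_apply ℝ _
  have hfd : ∀ p, HasFDerivAt w (fderiv ℝ w p) p := fun p =>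
    (hu.differentiable one_ne_zero p).hasFDerivAt
  have hdx : ∀ x y, HasDerivAt (fun t => u t y) (ux (x, y)) x := fun x y =>
    (hfd (x, y)).comp_hasDerivAt (f := fun t => (t, y)) x
      ((hasDerivAt_id x).prodMk (hasDerivAt_const x y))
  have hdy : ∀ x y, HasDerivAt (fun t => u x t) (uy (x, y)) y := fun x y =>
    (hfd (x, y)).comp_hasDerivAt (f := fun t => (x, t)) y
      ((hasDerivAt_const y x).prodMk (hasDerivAt_id y))
  have hexp : ∀ x : ℝ, Real.exp (2 * b * x) = Real.exp (b * x) ^ 2 := fun x => by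
    rw [← Real.exp_nat_mul]; ring_nf
  set E : ℝ × ℝ → ℝ := fun p => Real.exp (b * p.1) with hE_def
  have hE : Continuous E := by fun_prop
  have hvs : HasCompactSupport fun p => E p * w p := hsupp.mul_left
  have hGN := integral_strip_pow_four_le_mul (B := B) (v := fun p => E p * w p)
    (vx := fun p => E p * (ux p + b * w p)) (vy := fun p => E p * uy p) hvs
    (by fun_prop) (by fun_prop) (by fun_prop) (huxs.add hsupp.mul_left).mul_left huys.mul_left
    (fun x y => by
      convert! (((hasDerivAt_id x).const_mul b).exp).mul (hdx x y) using 1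
      simp only [hE_def, hw_def, id]
      ring)
    (fun x y => (hdy x y).const_mul (Real.exp (b * x))) (fun x => by simp [hw_def, hbd0])
  have hCS := sq_integral_mul_le (μ := volume.restrict (strip B)) (f := w)
    (g := fun p => (E p * w p) ^ 2)
    (Continuous.integrableOn_strip (by fun_prop) (hsupp.fun_pow_real two_ne_zero))
    (Continuous.integrableOn_strip (by fun_prop) hsupp.mul_right)
    (Continuous.integrableOn_strip (by fun_prop)
      ((hvs.fun_pow_real two_ne_zero).fun_pow_real two_ne_zero))
  have hX : ∫ p in strip B, (E p * (ux p + b * w p)) ^ 2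
      ≤ 2 * (∫ p in strip B, (E p * ux p) ^ 2)
        + 2 * b ^ 2 * ∫ p in strip B, (E p * w p) ^ 2 := by
    have hi₁ := Continuous.integrableOn_strip (B := B) (f := fun p => (E p * ux p) ^ 2) (by fun_prop)
      (huxs.mul_left.fun_pow_real two_ne_zero)
    have hi₂ := Continuous.integrableOn_strip (B := B) (f := fun p => (E p * w p) ^ 2) (by fun_prop)
      (hvs.fun_pow_real two_ne_zero)
    rw [← integral_const_mul, ← integral_const_mul,
      ← integral_add (hi₁.const_mul _) (hi₂.const_mul _)]
    refine integral_mono (Continuous.integrableOn_strip (by fun_prop)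
      ((huxs.add hsupp.mul_left).mul_left.fun_pow_real two_ne_zero))
      ((hi₁.const_mul _).add (hi₂.const_mul _)) fun p => ?_
    dsimp only
    nlinarith [sq_nonneg (E p * ux p - b * (E p * w p))]
  have hcubic : ∫ p in strip B, Real.exp (2*b*p.1) * (u p.1 p.2)^3
      = ∫ p in strip B, w p * (E p * w p) ^ 2 := by
    congr 1 with p
    rw [hexp]; ring
  have hYeq : ∫ p in strip B, Real.exp (2*b*p.1) * (deriv (fun y => u p.1 y) p.2)^2
      = ∫ p in strip B, (E p * uy p) ^ 2 := by
    congr 1 with p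
    rw [hexp, (hdy p.1 p.2).deriv]; ring
  have hXeq : ∫ p in strip B, Real.exp (2*b*p.1) * (deriv (fun x => u x p.2) p.1)^2
      = ∫ p in strip B, (E p * ux p) ^ 2 := by
    congr 1 with p
    rw [hexp, (hdx p.1 p.2).deriv]; ring
  have hAeq : ∫ p in strip B, Real.exp (2*b*p.1) * (u p.1 p.2)^2
      = ∫ p in strip B, (E p * w p) ^ 2 := by
    congr 1 with p
    rw [hexp]; ring
  rw [hcubic, hYeq, hXeq, hAeq]
  simp only [← pow_mul, Nat.reduceMul] at hCS
  have hA : 0 ≤ ∫ p in strip B, (E p * w p) ^ 2 := integral_nonneg fun p => sq_nonneg _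
  have hV : 0 ≤ ∫ p in strip B, (E p * (ux p + b * w p)) ^ 2 :=
    integral_nonneg fun p => sq_nonneg _
  have hY : 0 ≤ ∫ p in strip B, (E p * uy p) ^ 2 := integral_nonneg fun p => sq_nonneg _
  have hQ : 0 ≤ ∫ p in strip B, (E p * w p) ^ 4 := integral_nonneg fun p => by positivity
  change ∫ p in strip B, w p ^ 2 ≤ M ^ 2 at hL2
  generalize (∫ p in strip B, w p * (E p * w p) ^ 2) = I at *
  generalize (∫ p in strip B, w p ^ 2) = L at *
  generalize (∫ p in strip B, (E p * w p) ^ 2) = A at *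
  generalize (∫ p in strip B, (E p * (ux p + b * w p)) ^ 2) = V at *
  generalize (∫ p in strip B, (E p * uy p) ^ 2) = Y at *
  generalize (∫ p in strip B, (E p * w p) ^ 4) = Q at *
  generalize (∫ p in strip B, (E p * ux p) ^ 2) = X at *
  have hI : I ^ 2 ≤ M ^ 2 * (2 * (A * (V + Y))) :=
    hCS.trans (mul_le_mul hL2 hGN hQ (sq_nonneg M))
  have hyoung : 4 / 3 * I ≤ V + Y + 16 / 9 * (M ^ 2 * A) := by
    refine abs_le_of_sq_le_sq' ?_ (by positivity) |>.2
    have hMA : 0 ≤ M ^ 2 * A := by positivity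
    nlinarith [sq_nonneg (V + Y - 16 / 9 * (M ^ 2 * A)), mul_nonneg hMA (add_nonneg hV hY)]
  linarith [mul_le_mul_of_nonneg_left (hyoung.trans (add_le_add_left (add_le_add_left hX Y) _))
    hb.le]
end

section
/- Fix B > 0 and let S = ℝ × (0,B). Let v be a twice continuously differentiable function on ℝ × [0,B] such that v, v_x, v_y and v_{xy} are square-integrable on S, v(x,y) → 0 as |x| → ∞ uniformly in y ∈ [0,B], and for every x ∈ ℝ there exists y₀ ∈ [0,B] with v(x,y₀) = 0. Then for every δ > 0: sup_{(x,y) ∈ S} v(x,y)² ≤ δ (‖v_y‖² + ‖v_{xy}‖²) + (1/δ) (‖v_x‖² + ‖v‖²), where ‖·‖ denotes the L²(S)-norm. -/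
open MeasureTheory Real Set

/-- On `[0, B]`, the square of a function vanishing somewhere is bounded by `2 ∫ |f f'|`. -/
lemma sq_le_two_mul_integral_abs_mul_deriv {B : ℝ} {f f' : ℝ → ℝ}
    (hf : ∀ y, HasDerivAt f (f' y) y) (hf' : Continuous f')
    {y₀ y : ℝ} (hy₀ : y₀ ∈ Icc 0 B) (hy : y ∈ Icc 0 B) (h₀ : f y₀ = 0) :
    f y ^ 2 ≤ 2 * ∫ t in Ioo 0 B, |f t * f' t| := by
  have hfc : Continuous f := continuous_iff_continuousAt.2 fun t => (hf t).continuousAt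
  have hd : ∀ t, HasDerivAt (fun t => f t ^ 2) (2 * (f t * f' t)) t := fun t => by
    refine ((hf t).pow 2).congr_deriv ?_
    ring
  have hftc : ∫ t in y₀..y, 2 * (f t * f' t) = f y ^ 2 := by
    rw [intervalIntegral.integral_eq_sub_of_hasDerivAt (fun t _ => hd t)
      ((by fun_prop : Continuous fun t => 2 * (f t * f' t)).intervalIntegrable _ _), h₀]
    ring
  have hsub : uIoc y₀ y ⊆ Ioc 0 B := by
    intro t ht
    rw [mem_uIoc] at ht
    obtain ⟨_, _⟩ := hy₀
    obtain ⟨_, _⟩ := hy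
    rcases ht with ⟨_, _⟩ | ⟨_, _⟩ <;> constructor <;> linarith
  calc f y ^ 2 ≤ ‖∫ t in y₀..y, 2 * (f t * f' t)‖ := by
        rw [hftc]; exact le_abs_self _
    _ ≤ ∫ t in uIoc y₀ y, ‖2 * (f t * f' t)‖ :=
        intervalIntegral.norm_integral_le_integral_norm_uIoc
    _ ≤ ∫ t in Ioc 0 B, ‖2 * (f t * f' t)‖ := by
        refine setIntegral_mono_set ?_ (ae_of_all _ fun t => norm_nonneg _) hsub.eventuallyLE
        exact (by fun_prop : Continuous fun t => ‖2 * (f t * f' t)‖).integrableOn_Ioc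
    _ = 2 * ∫ t in Ioo 0 B, |f t * f' t| := by
        rw [integral_Ioc_eq_integral_Ioo, ← integral_const_mul]
        simp [abs_mul]

/-- A function changes in absolute value by at most the integral of the absolute value of its
derivative. -/
lemma abs_le_abs_add_integral_abs_deriv {g g' : ℝ → ℝ} (hg : ∀ s, HasDerivAt g (g' s) s)
    (hg' : Integrable g') (a b : ℝ) : |g b| ≤ |g a| + ∫ s, |g' s| := by
  have hftc : ∫ s in a..b, g' s = g b - g a :=
    intervalIntegral.integral_eq_sub_of_hasDerivAt (fun s _ => hg s) hg'.intervalIntegrable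
  have h : |g b - g a| ≤ ∫ s, |g' s| := by
    rw [← hftc]
    refine (intervalIntegral.norm_integral_le_integral_norm_uIoc (f := g')).trans ?_
    exact setIntegral_le_integral hg'.norm (ae_of_all _ fun s => norm_nonneg _)
  linarith [abs_sub_abs_le_abs_sub (g b) (g a)]

/-- If `w` and its derivative in the first variable are integrable on a product `ℝ × Y`, then the
`L¹` norm of every slice `w (x, ·)` is bounded by the `L¹` norm of the derivative. -/
lemma integral_abs_slice_le_integral_abs_deriv {Y : Type*} [MeasurableSpace Y] {ν : Measure Y}
    [SFinite ν] {w wx : ℝ × Y → ℝ} (hd : ∀ x y, HasDerivAt (fun s => w (s, y)) (wx (x, y)) x)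
    (hw : Integrable w (volume.prod ν)) (hwx : Integrable wx (volume.prod ν))
    (hslice : ∀ x, Integrable (fun y => w (x, y)) ν) (x : ℝ) :
    ∫ y, |w (x, y)| ∂ν ≤ ∫ p, |wx p| ∂(volume.prod ν) := by
  refine le_of_forall_pos_lt_add fun ε hε => ?_
  obtain ⟨x₀, hx₀⟩ : ∃ x₀, ∫ y, |w (x₀, y)| ∂ν < ε := by
    by_contra! hcon
    have hG : Integrable (fun s => ∫ y, |w (s, y)| ∂ν) := hw.norm.integral_prod_left
    have hc : Integrable (fun _ : ℝ => ε) :=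
      hG.mono' aestronglyMeasurable_const (ae_of_all _ fun s => by
        rw [norm_of_nonneg hε.le]; exact hcon s)
    rw [integrable_const_iff] at hc
    rcases hc with hc | hc
    · exact hε.ne' hc
    · exact (measure_lt_top (volume : Measure ℝ) univ).ne volume_univ
  have hI : Integrable (fun y => ∫ s, |wx (s, y)|) ν := hwx.abs.integral_prod_right
  calc ∫ y, |w (x, y)| ∂ν ≤ ∫ y, (|w (x₀, y)| + ∫ s, |wx (s, y)|) ∂ν := by
        refine integral_mono_ae (hslice x).abs ((hslice x₀).abs.add hI) ?_
        filter_upwards [hwx.prod_left_ae] with y hy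
        exact abs_le_abs_add_integral_abs_deriv (fun s => hd s y) hy x₀ x
    _ = (∫ y, |w (x₀, y)| ∂ν) + ∫ p, |wx p| ∂(volume.prod ν) := by
        rw [integral_add (hslice x₀).abs hI, integral_prod_symm _ hwx.abs]
    _ < (∫ p, |wx p| ∂(volume.prod ν)) + ε := by linarith

lemma two_mul_abs_mul_add_mul_le {δ : ℝ} (hδ : 0 < δ) (a b c d : ℝ) :
    2 * |a * b + c * d| ≤ δ * (b ^ 2 + d ^ 2) + 1 / δ * (a ^ 2 + c ^ 2) := by
  have key : ∀ s t : ℝ, 2 * |s * t| ≤ δ * t ^ 2 + 1 / δ * s ^ 2 := fun s t => by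
    have h : δ * t ^ 2 + 1 / δ * s ^ 2 - 2 * (|s| * |t|) = (δ * |t| - |s|) ^ 2 / δ := by
      rw [← sq_abs s, ← sq_abs t]
      field_simp
      ring
    have : 0 ≤ (δ * |t| - |s|) ^ 2 / δ := by positivity
    rw [abs_mul]
    linarith
  linarith [abs_add_le (a * b) (c * d), key a b, key c d]

/-- The supremum estimate for a function whose partial derivatives are given explicitly. -/
lemma sq_le_of_hasDerivAt_strip {B : ℝ} {v vx vy vxy : ℝ × ℝ → ℝ}
    (hx : ∀ x y, HasDerivAt (fun s => v (s, y)) (vx (x, y)) x)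
    (hy : ∀ x y, HasDerivAt (fun t => v (x, t)) (vy (x, y)) y)
    (hxy : ∀ x y, HasDerivAt (fun s => vy (s, y)) (vxy (x, y)) x)
    (cv : Continuous v) (cvx : Continuous vx) (cvy : Continuous vy) (cvxy : Continuous vxy)
    (iv : IntegrableOn (fun p => v p ^ 2) (strip B))
    (ivx : IntegrableOn (fun p => vx p ^ 2) (strip B))
    (ivy : IntegrableOn (fun p => vy p ^ 2) (strip B))
    (ivxy : IntegrableOn (fun p => vxy p ^ 2) (strip B))
    (hzero : ∀ x, ∃ y₀ ∈ Icc 0 B, v (x, y₀) = 0)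
    {δ : ℝ} (hδ : 0 < δ) (x : ℝ) {y : ℝ} (hyB : y ∈ Icc 0 B) :
    v (x, y) ^ 2 ≤ δ * ((∫ p in strip B, vy p ^ 2) + ∫ p in strip B, vxy p ^ 2)
      + 1 / δ * ((∫ p in strip B, vx p ^ 2) + ∫ p in strip B, v p ^ 2) := by
  have memLp : ∀ {f : ℝ × ℝ → ℝ}, Continuous f → IntegrableOn (fun p => f p ^ 2) (strip B) →
      MemLp f 2 (volume.restrict (strip B)) := fun hf hi =>
    (memLp_two_iff_integrable_sq hf.aestronglyMeasurable).2 hi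
  have hw : IntegrableOn (fun p => v p * vy p) (strip B) :=
    (memLp cv iv).integrable_mul (memLp cvy ivy)
  have hwx : IntegrableOn (fun p => vx p * vy p + v p * vxy p) (strip B) :=
    ((memLp cvx ivx).integrable_mul (memLp cvy ivy)).add
      ((memLp cv iv).integrable_mul (memLp cvxy ivxy))
  obtain ⟨y₀, hy₀, h₀⟩ := hzero x
  have hvert : v (x, y) ^ 2 ≤ 2 * ∫ t in Ioo 0 B, |v (x, t) * vy (x, t)| :=
    sq_le_two_mul_integral_abs_mul_deriv (fun t => hy x t) (by fun_prop) hy₀ hyB h₀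
  have hhor : ∫ t in Ioo 0 B, |v (x, t) * vy (x, t)|
      ≤ ∫ p in strip B, |vx p * vy p + v p * vxy p| := by
    rw [IntegrableOn, volume_restrict_strip] at hw hwx
    rw [volume_restrict_strip]
    refine integral_abs_slice_le_integral_abs_deriv
      (w := fun p => v p * vy p) (fun s t => (hx s t).mul (hxy s t)) hw hwx (fun s => ?_) x
    exact ((by fun_prop : Continuous fun t => v (s, t) * vy (s, t)).integrableOn_Icc).mono_set
      Ioo_subset_Icc_self
  have iy : IntegrableOn (fun p => δ * (vy p ^ 2 + vxy p ^ 2)) (strip B) :=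
    (ivy.add ivxy).const_mul δ
  have ix : IntegrableOn (fun p => 1 / δ * (vx p ^ 2 + v p ^ 2)) (strip B) :=
    (ivx.add iv).const_mul (1 / δ)
  calc v (x, y) ^ 2 ≤ ∫ p in strip B, 2 * |vx p * vy p + v p * vxy p| := by
        rw [integral_const_mul]; linarith
    _ ≤ ∫ p in strip B, (δ * (vy p ^ 2 + vxy p ^ 2) + 1 / δ * (vx p ^ 2 + v p ^ 2)) :=
        integral_mono (hwx.abs.const_mul 2) (Integrable.add iy ix)
          fun p => two_mul_abs_mul_add_mul_le hδ _ _ _ _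
    _ = _ := by
        rw [integral_add iy ix, integral_const_mul, integral_const_mul,
          integral_add ivy ivxy, integral_add ivx iv]

lemma hasDerivAt_fst_slice {E : Type*} [NormedAddCommGroup E] [NormedSpace ℝ E] {F : ℝ × ℝ → E}
    (hF : Differentiable ℝ F) (x y : ℝ) :
    HasDerivAt (fun s => F (s, y)) (fderiv ℝ F (x, y) (1, 0)) x :=
  HasFDerivAt.comp_hasDerivAt (f := fun s : ℝ => (s, y)) x (hF (x, y)).hasFDerivAt
    ((hasDerivAt_id x).prodMk (hasDerivAt_const x y))

lemma hasDerivAt_snd_slice {E : Type*} [NormedAddCommGroup E] [NormedSpace ℝ E] {F : ℝ × ℝ → E}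
    (hF : Differentiable ℝ F) (x y : ℝ) :
    HasDerivAt (fun t => F (x, t)) (fderiv ℝ F (x, y) (0, 1)) y :=
  HasFDerivAt.comp_hasDerivAt (f := fun t : ℝ => (x, t)) y (hF (x, y)).hasFDerivAt
    ((hasDerivAt_const y x).prodMk (hasDerivAt_id y))

/-- **Anisotropic supremum estimate** (from Lemma 3.3 of the paper).
Fix `B > 0` and let `S = ℝ × (0,B)`. Let `v` be twice continuously differentiable,
with `v, v_x, v_y, v_xy` square-integrable on `S`, `v(x,y) → 0` as `|x| → ∞`
uniformly in `y ∈ [0,B]`, and such that for every `x` there is `y₀ ∈ [0,B]` with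
`v(x,y₀) = 0`. Then for every `δ > 0`,
`sup_S v² ≤ δ (‖v_y‖² + ‖v_xy‖²) + (1/δ)(‖v_x‖² + ‖v‖²)`. -/
theorem sup_estimate_strip (B : ℝ) (hB : 0 < B) (v : ℝ → ℝ → ℝ)
    (hv : ContDiff ℝ 2 (fun p : ℝ × ℝ => v p.1 p.2))
    (hv2 : IntegrableOn (fun p : ℝ × ℝ => (v p.1 p.2)^2) (strip B) volume)
    (hvx2 : IntegrableOn (fun p : ℝ × ℝ => (deriv (fun x => v x p.2) p.1)^2) (strip B) volume)
    (hvy2 : IntegrableOn (fun p : ℝ × ℝ => (deriv (fun y => v p.1 y) p.2)^2) (strip B) volume)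
    (hvxy2 : IntegrableOn
      (fun p : ℝ × ℝ => (deriv (fun y => deriv (fun x => v x y) p.1) p.2)^2) (strip B) volume)
    (hdecay : ∀ ε : ℝ, 0 < ε → ∃ R : ℝ, ∀ x : ℝ, R ≤ |x| → ∀ y ∈ Set.Icc (0:ℝ) B,
      |v x y| ≤ ε)
    (hzero : ∀ x : ℝ, ∃ y₀ ∈ Set.Icc (0:ℝ) B, v x y₀ = 0) :
    ∀ δ : ℝ, 0 < δ → ∀ x : ℝ, ∀ y ∈ Set.Ioo (0:ℝ) B,
      (v x y)^2 ≤
        δ * ((∫ p in strip B, (deriv (fun y' => v p.1 y') p.2)^2)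
              + (∫ p in strip B, (deriv (fun y' => deriv (fun x' => v x' y') p.1) p.2)^2))
        + (1/δ) * ((∫ p in strip B, (deriv (fun x' => v x' p.2) p.1)^2)
              + (∫ p in strip B, (v p.1 p.2)^2)) := by
  intro δ hδ x y hy
  set V : ℝ × ℝ → ℝ := fun p => v p.1 p.2
  have dV : Differentiable ℝ V := hv.differentiable (by norm_num)
  have cDV : ContDiff ℝ 1 (fderiv ℝ V) := hv.fderiv_right (by norm_num)
  have dDV : Differentiable ℝ (fderiv ℝ V) := cDV.differentiable (by norm_num)
  have hx : ∀ s t, HasDerivAt (fun s => v s t) (fderiv ℝ V (s, t) (1, 0)) s :=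
    hasDerivAt_fst_slice dV
  have hy' : ∀ s t, HasDerivAt (fun t => v s t) (fderiv ℝ V (s, t) (0, 1)) t :=
    hasDerivAt_snd_slice dV
  have hyx : ∀ s t, HasDerivAt (fun t => fderiv ℝ V (s, t) (1, 0))
      (fderiv ℝ (fderiv ℝ V) (s, t) (0, 1) (1, 0)) t := fun s t =>
    (ContinuousLinearMap.apply ℝ ℝ ((1 : ℝ), (0 : ℝ))).hasFDerivAt.comp_hasDerivAt t
      (hasDerivAt_snd_slice dDV s t)
  have hxy : ∀ s t, HasDerivAt (fun s => fderiv ℝ V (s, t) (0, 1))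
      (fderiv ℝ (fderiv ℝ V) (s, t) (0, 1) (1, 0)) s := fun s t => by
    rw [second_derivative_symmetric (fun p => (dV p).hasFDerivAt) (dDV (s, t)).hasFDerivAt]
    exact (ContinuousLinearMap.apply ℝ ℝ ((0 : ℝ), (1 : ℝ))).hasFDerivAt.comp_hasDerivAt s
      (hasDerivAt_fst_slice dDV s t)
  have cD : Continuous (fderiv ℝ V) := cDV.continuous
  have cDD : Continuous (fderiv ℝ (fderiv ℝ V)) := cDV.continuous_fderiv (by norm_num)
  simp only [(hx _ _).deriv, (hy' _ _).deriv, (hyx _ _).deriv] at hvx2 hvy2 hvxy2 ⊢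
  exact sq_le_of_hasDerivAt_strip (v := V) (vx := fun p => fderiv ℝ V p (1, 0))
    (vy := fun p => fderiv ℝ V p (0, 1))
    (vxy := fun p => fderiv ℝ (fderiv ℝ V) p (0, 1) (1, 0)) hx hy' hxy
    hv.continuous (by fun_prop) (by fun_prop) (by fun_prop) hv2 hvx2 hvy2 hvxy2 hzero hδ x
    (Ioo_subset_Icc_self hy)
end
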